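/- arXiv:2204.12493 — 8 statements merged into one kernel-verified Lean document; each statement's English description precedes it below -/
import Mathlib

section
/- Let P be a real d×d symmetric idempotent matrix (Pᵀ = P and P² = P), μ ≥ 0 a real number, and w, wᵢ ∈ ℝᵈ. Then v = wᵢ + (I − (μ/(1+μ)) P)(w − wᵢ) is a global minimizer of the objective F(u) = ‖w − u‖₂² + μ‖P(u − wᵢ)‖₂², i.e., for every u ∈ ℝᵈ, ‖w − v‖₂² + μ‖P(v − wᵢ)‖₂² ≤ ‖w − u‖₂² + μ‖P(u − wᵢ)‖₂². -/
open Matrix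

section

variable {E : Type*} [NormedAddCommGroup E] [InnerProductSpace ℝ E]

lemma norm_sq_apply_le_of_isSymmetric_of_idempotent {T : E →ₗ[ℝ] E} (hT : T.IsSymmetric)
    (hid : ∀ x, T (T x) = T x) (x : E) : ‖T x‖ ^ 2 ≤ ‖x‖ ^ 2 := by
  have hinner : inner ℝ x (T x) = ‖T x‖ ^ 2 := by
    rw [← real_inner_self_eq_norm_sq, hT x (T x), hid]
  have hsub := norm_sub_sq_real x (T x)
  nlinarith [sq_nonneg ‖x - T x‖]

lemma mul_norm_sq_le_norm_sub_sq_add {μ : ℝ} (hμ : 0 ≤ μ) (p q : E) :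
    μ / (1 + μ) * ‖p‖ ^ 2 ≤ ‖p - q‖ ^ 2 + μ * ‖q‖ ^ 2 := by
  have hsq := norm_sub_sq_real p ((1 + μ) • q)
  rw [inner_smul_right, norm_smul, mul_pow, Real.norm_eq_abs, sq_abs] at hsq
  rw [div_mul_eq_mul_div, div_le_iff₀ (by positivity), norm_sub_sq_real p q]
  nlinarith [sq_nonneg ‖p - (1 + μ) • q‖]

end

/-- For a symmetric idempotent matrix `P`, `μ ≥ 0`, and `w, wᵢ ∈ ℝᵈ`, the vector
`v = wᵢ + (I − (μ/(1+μ)) P)(w − wᵢ)` is a global minimizer of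
`F(u) = ‖w − u‖₂² + μ‖P(u − wᵢ)‖₂²`. -/
theorem stmt_4 {d : ℕ} (P : Matrix (Fin d) (Fin d) ℝ)
    (hPsym : Pᵀ = P) (hPidem : P * P = P)
    (μ : ℝ) (hμ : 0 ≤ μ) (w wi : EuclideanSpace ℝ (Fin d)) :
    ∀ u : EuclideanSpace ℝ (Fin d),
      ‖w - (wi + Matrix.toEuclideanLin (1 - (μ / (1 + μ)) • P) (w - wi))‖ ^ 2
        + μ * ‖Matrix.toEuclideanLin P
            ((wi + Matrix.toEuclideanLin (1 - (μ / (1 + μ)) • P) (w - wi)) - wi)‖ ^ 2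
      ≤ ‖w - u‖ ^ 2 + μ * ‖Matrix.toEuclideanLin P (u - wi)‖ ^ 2 := by
  intro u
  set T := Matrix.toEuclideanLin P with hTdef
  have hT : T.IsSymmetric := Matrix.isSymmetric_toEuclideanLin_iff.2
    (by rwa [Matrix.IsHermitian, Matrix.conjTranspose_eq_transpose_of_trivial])
  have hid (x) : T (T x) = T x := by
    simp [hTdef, Matrix.toLpLin_apply, Matrix.mulVec_mulVec, hPidem]
  have hstep : Matrix.toEuclideanLin (1 - (μ / (1 + μ)) • P) (w - wi)
      = (w - wi) - (μ / (1 + μ)) • T (w - wi) := by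
    rw [map_sub Matrix.toEuclideanLin, map_smul, LinearMap.sub_apply, LinearMap.smul_apply, Matrix.toLpLin_one,
      LinearMap.id_apply]
  have hμ' : 1 + μ ≠ 0 := by positivity
  have hres : w - (wi + ((w - wi) - (μ / (1 + μ)) • T (w - wi)))
      = (μ / (1 + μ)) • T (w - wi) := by abel
  have hproj : T (wi + ((w - wi) - (μ / (1 + μ)) • T (w - wi)) - wi)
      = (1 - μ / (1 + μ)) • T (w - wi) := by
    rw [add_sub_cancel_left, map_sub, map_smul, hid, sub_smul, one_smul]
  have hcontr := norm_sq_apply_le_of_isSymmetric_of_idempotent hT hid ((w - wi) - (u - wi))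
  rw [map_sub, sub_sub_sub_cancel_right] at hcontr
  rw [hstep, hres, hproj, norm_smul, norm_smul, mul_pow, mul_pow, Real.norm_eq_abs,
    Real.norm_eq_abs, sq_abs, sq_abs]
  calc _ = μ / (1 + μ) * ‖T (w - wi)‖ ^ 2 := by field_simp; ring
    _ ≤ ‖T (w - wi) - T (u - wi)‖ ^ 2 + μ * ‖T (u - wi)‖ ^ 2 :=
      mul_norm_sq_le_norm_sub_sq_add hμ _ _
    _ ≤ _ := by gcongr
end

section
/- Let w, v₁, …, v_N ∈ ℝᵈ, let P₁, …, P_N be real d×d symmetric idempotent matrices, and let C, v*, α₁*, …, α_N*, ε₁*, …, ε_N* be real numbers. Suppose: (i) d* = −Σᵢ 2αᵢ* Pᵢ(w − vᵢ); (ii) Σᵢ αᵢ* = 1; (iii) complementary slackness αᵢ*(2⟨Pᵢ(w − vᵢ), d*⟩ − v* − εᵢ*) = 0 for all i; and (iv) αᵢ* εᵢ* = C εᵢ* for all i. Then v* = −‖d*‖₂² − C Σᵢ εᵢ*. -/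
open Matrix

/-- KKT consequence (Proposition 1, part of the proof): under the stationarity, dual
feasibility, complementary slackness, and multiplier conditions, the optimal value satisfies
`v* = −‖d*‖₂² − C Σᵢ εᵢ*`. -/
theorem stmt_7 {d N : ℕ} (w : Fin d → ℝ) (v : Fin N → Fin d → ℝ)
    (P : Fin N → Matrix (Fin d) (Fin d) ℝ)
    (hsym : ∀ i, (P i)ᵀ = P i) (hidem : ∀ i, P i * P i = P i)
    (C vstar : ℝ) (α ε : Fin N → ℝ) (dstar : Fin d → ℝ)
    (h1 : dstar = -∑ i, (2 * α i) • (P i).mulVec (w - v i))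
    (h2 : ∑ i, α i = 1)
    (h3 : ∀ i, α i * (2 * ((P i).mulVec (w - v i) ⬝ᵥ dstar) - vstar - ε i) = 0)
    (h4 : ∀ i, α i * ε i = C * ε i) :
    vstar = -(dstar ⬝ᵥ dstar) - C * ∑ i, ε i := by
  have hdd : dstar ⬝ᵥ dstar =
      -∑ i, 2 * α i * ((P i).mulVec (w - v i) ⬝ᵥ dstar) := by
    conv_lhs => enter [1]; rw [h1]
    simp only [neg_dotProduct, sum_dotProduct, smul_dotProduct, smul_eq_mul]
  have hslack : ∑ i, (2 * α i * ((P i).mulVec (w - v i) ⬝ᵥ dstar) - α i * vstar - C * ε i) = 0 :=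
    Finset.sum_eq_zero fun i _ => by linear_combination h3 i + h4 i
  rw [Finset.sum_sub_distrib, Finset.sum_sub_distrib, ← Finset.sum_mul, ← Finset.mul_sum, h2]
    at hslack
  linear_combination -hslack + hdd
end

section
/- Let w, v₁, …, v_N ∈ ℝᵈ, let P₁, …, P_N be real d×d symmetric idempotent matrices, and let C, v*, α₁*, …, α_N*, ε₁*, …, ε_N* be real numbers. Suppose: (i) d* = −Σᵢ 2αᵢ* Pᵢ(w − vᵢ); (ii) Σᵢ αᵢ* = 1; (iii) αᵢ*(2⟨Pᵢ(w − vᵢ), d*⟩ − v* − εᵢ*) = 0 for all i; (iv) αᵢ* εᵢ* = C εᵢ* for all i; and (v) feasibility: 2⟨Pᵢ(w − vᵢ), d*⟩ ≤ v* + εᵢ* for all i. Then for every i = 1, …, N, 2⟨Pᵢ(w − vᵢ), d*⟩ ≤ −‖d*‖₂² + εᵢ* − C Σₙ εₙ*. -/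
open Matrix

/-- Proposition 1, part 2: under the KKT conditions together with primal feasibility, for
every `i`, `2⟨Pᵢ(w − vᵢ), d*⟩ ≤ −‖d*‖₂² + εᵢ* − C Σₙ εₙ*`. -/
theorem stmt_8 {d N : ℕ} (w : Fin d → ℝ) (v : Fin N → Fin d → ℝ)
    (P : Fin N → Matrix (Fin d) (Fin d) ℝ)
    (hsym : ∀ i, (P i)ᵀ = P i) (hidem : ∀ i, P i * P i = P i)
    (C vstar : ℝ) (α ε : Fin N → ℝ) (dstar : Fin d → ℝ)
    (h1 : dstar = -∑ i, (2 * α i) • (P i).mulVec (w - v i))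
    (h2 : ∑ i, α i = 1)
    (h3 : ∀ i, α i * (2 * ((P i).mulVec (w - v i) ⬝ᵥ dstar) - vstar - ε i) = 0)
    (h4 : ∀ i, α i * ε i = C * ε i)
    (h5 : ∀ i, 2 * ((P i).mulVec (w - v i) ⬝ᵥ dstar) ≤ vstar + ε i) :
    ∀ i, 2 * ((P i).mulVec (w - v i) ⬝ᵥ dstar)
      ≤ -(dstar ⬝ᵥ dstar) + ε i - C * ∑ n, ε n := by
  intro i
  have hnorm : dstar ⬝ᵥ dstar = -∑ n, 2 * α n * ((P n).mulVec (w - v n) ⬝ᵥ dstar) := by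
    conv_lhs => enter [1]; rw [h1]
    simp only [neg_dotProduct, sum_dotProduct, smul_dotProduct, smul_eq_mul]
  have hsum : ∑ n, 2 * α n * ((P n).mulVec (w - v n) ⬝ᵥ dstar) = vstar + C * ∑ n, ε n := by
    calc ∑ n, 2 * α n * ((P n).mulVec (w - v n) ⬝ᵥ dstar)
        = ∑ n, (α n * vstar + C * ε n) :=
          Finset.sum_congr rfl fun n _ => by linear_combination h3 n + h4 n
      _ = vstar + C * ∑ n, ε n := by
          rw [Finset.sum_add_distrib, ← Finset.sum_mul, h2, one_mul, Finset.mul_sum]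
  linarith [h5 i]
end

section
/- Let E be a real inner product space, w, w*, g, d ∈ E, and let c, M, G, λ, η be real numbers with λ ≥ 0, η ≥ 0, ‖g‖ ≤ M, ‖d‖ ≤ G, and ⟨w* − w, g⟩ ≤ −(c/2)‖w − w*‖². Then the updated point w₊ = w − λ g + η d satisfies ‖w₊ − w*‖² ≤ (1 − cλ + η)‖w − w*‖² + η G² + 2λ² M² + 2η² G². -/
open RealInnerProductSpace

/-- One-step recursion: with `‖g‖ ≤ M`, `‖d‖ ≤ G`, and the strong-convexity descent property
`⟨w* − w, g⟩ ≤ −(c/2)‖w − w*‖²`, the update `w₊ = w − λg + ηd` satisfies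
`‖w₊ − w*‖² ≤ (1 − cλ + η)‖w − w*‖² + ηG² + 2λ²M² + 2η²G²`. -/
theorem stmt_10 {E : Type*} [NormedAddCommGroup E] [InnerProductSpace ℝ E]
    (w wstar g d : E) (c M G lam eta : ℝ)
    (hlam : 0 ≤ lam) (heta : 0 ≤ eta)
    (hg : ‖g‖ ≤ M) (hd : ‖d‖ ≤ G)
    (hip : ⟪wstar - w, g⟫ ≤ -(c / 2) * ‖w - wstar‖ ^ 2) :
    ‖(w - lam • g + eta • d) - wstar‖ ^ 2
      ≤ (1 - c * lam + eta) * ‖w - wstar‖ ^ 2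
        + eta * G ^ 2 + 2 * lam ^ 2 * M ^ 2 + 2 * eta ^ 2 * G ^ 2 := by
  set u := w - wstar with hu
  have hdecomp : (w - lam • g + eta • d) - wstar = u + (eta • d - lam • g) := by
    rw [hu]; abel
  have hneg : ⟪wstar - w, g⟫ = -⟪u, g⟫ := by
    rw [hu, ← inner_neg_left, neg_sub]
  have hexpand : ‖u + (eta • d - lam • g)‖ ^ 2
      = ‖u‖ ^ 2 + 2 * (eta * ⟪u, d⟫ - lam * ⟪u, g⟫) + ‖eta • d - lam • g‖ ^ 2 := by
    rw [norm_add_sq_real, inner_sub_right, real_inner_smul_right, real_inner_smul_right]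
  have hdescent : lam * -⟪u, g⟫ ≤ lam * (-(c / 2) * ‖u‖ ^ 2) :=
    mul_le_mul_of_nonneg_left (hneg ▸ hip) hlam
  have hG : ‖d‖ ^ 2 ≤ G ^ 2 := by gcongr
  have hM : ‖g‖ ^ 2 ≤ M ^ 2 := by gcongr
  have hyoung : 2 * ⟪u, d⟫ ≤ ‖u‖ ^ 2 + G ^ 2 := by
    nlinarith [norm_sub_sq_real u d, sq_nonneg ‖u - d‖]
  have hyoung' := mul_le_mul_of_nonneg_left hyoung heta
  have hstep : ‖eta • d - lam • g‖ ^ 2 ≤ 2 * (eta ^ 2 * ‖d‖ ^ 2) + 2 * (lam ^ 2 * ‖g‖ ^ 2) := by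
    have hpar := parallelogram_law_with_norm ℝ (eta • d) (lam • g)
    have hd_sq : ‖eta • d‖ ^ 2 = eta ^ 2 * ‖d‖ ^ 2 := by
      rw [norm_smul, mul_pow, Real.norm_eq_abs, sq_abs]
    have hg_sq : ‖lam • g‖ ^ 2 = lam ^ 2 * ‖g‖ ^ 2 := by
      rw [norm_smul, mul_pow, Real.norm_eq_abs, sq_abs]
    nlinarith [sq_nonneg ‖eta • d + lam • g‖]
  have hG' := mul_le_mul_of_nonneg_left hG (sq_nonneg eta)
  have hM' := mul_le_mul_of_nonneg_left hM (sq_nonneg lam)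
  rw [hdecomp, hexpand]
  linarith
end

section
/- Define π_k = 2 / ((k+1)²(k+2)) and η_s = 1/((s+2)(s+1)) for natural numbers k, s. Then for every natural number k, Σ_{s=0}^{k} (π_k / π_s) (2 η_s² + η_s) ≤ 2/((k+1)(k+2)) + 1/(2(k+2)). -/
/-- Accumulated contraction factor `π_k = 2/((k+1)²(k+2))`. -/
noncomputable def piK (k : ℕ) : ℝ := 2 / (((k : ℝ) + 1) ^ 2 * ((k : ℝ) + 2))

/-- MA-Echo step size `η_s = 1/((s+2)(s+1))`. -/
noncomputable def etaS (s : ℕ) : ℝ := 1 / (((s : ℝ) + 2) * ((s : ℝ) + 1))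

theorem two_mul_etaS_sq_add_etaS_div_piK_le (s : ℕ) :
    (2 * etaS s ^ 2 + etaS s) / piK s ≤ ((s : ℝ) + 2) / 2 := by
  have hs : (0 : ℝ) ≤ s := s.cast_nonneg
  have h : (2 * etaS s ^ 2 + etaS s) / piK s = 1 / ((s : ℝ) + 2) + ((s : ℝ) + 1) / 2 := by
    unfold etaS piK
    field_simp
  have h2 : 1 / ((s : ℝ) + 2) ≤ 1 / 2 := one_div_le_one_div_of_le two_pos (by linarith)
  rw [h]
  linarith

theorem sum_range_succ_add_two_div_two (k : ℕ) :
    ∑ s ∈ Finset.range (k + 1), ((s : ℝ) + 2) / 2 = ((k : ℝ) + 1) * ((k : ℝ) + 4) / 4 := by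
  induction k with
  | zero => norm_num
  | succ n ih =>
    rw [Finset.sum_range_succ, ih]
    push_cast
    ring

/-- `Σ_{s=0}^{k} (π_k/π_s)(2η_s² + η_s) ≤ 2/((k+1)(k+2)) + 1/(2(k+2))`. -/
theorem stmt_13 (k : ℕ) :
    ∑ s ∈ Finset.range (k + 1), (piK k / piK s) * (2 * etaS s ^ 2 + etaS s)
      ≤ 2 / (((k : ℝ) + 1) * ((k : ℝ) + 2)) + 1 / (2 * ((k : ℝ) + 2)) := by
  have hπ : 0 ≤ piK k := by unfold piK; positivity
  calc ∑ s ∈ Finset.range (k + 1), (piK k / piK s) * (2 * etaS s ^ 2 + etaS s)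
      = piK k * ∑ s ∈ Finset.range (k + 1), (2 * etaS s ^ 2 + etaS s) / piK s := by
        rw [Finset.mul_sum]
        exact Finset.sum_congr rfl fun s _ => by ring
    _ ≤ piK k * ∑ s ∈ Finset.range (k + 1), ((s : ℝ) + 2) / 2 := by
        exact mul_le_mul_of_nonneg_left
          (Finset.sum_le_sum fun s _ => two_mul_etaS_sq_add_etaS_div_piK_le s) hπ
    _ = ((k : ℝ) + 4) / (2 * (((k : ℝ) + 1) * ((k : ℝ) + 2))) := by
        rw [sum_range_succ_add_two_div_two]
        unfold piK
        field_simp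
        norm_num
    _ ≤ ((k : ℝ) + 5) / (2 * (((k : ℝ) + 1) * ((k : ℝ) + 2))) := by
        gcongr
        norm_num
    _ = 2 / (((k : ℝ) + 1) * ((k : ℝ) + 2)) + 1 / (2 * ((k : ℝ) + 2)) := by
        field_simp
        ring
end

section
/- Let c > 0 be real and define π_k = 2 / ((k+1)²(k+2)) and λ_s = 3/(c(s+2)) for natural numbers k, s. Then for every natural number k, Σ_{s=0}^{k} (π_k / π_s) (2 λ_s²) ≤ 18 / (c²(k+2)). -/
/-- Averaging step size `λ_s = 3/(c(s+2))`. -/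
noncomputable def lamS (c : ℝ) (s : ℕ) : ℝ := 3 / (c * ((s : ℝ) + 2))

/-- Each weighted term is at most the average `18/(c²(k+2)(k+1))`. -/
theorem piK_div_mul_lamS_sq_le {c : ℝ} (hc : 0 < c) {s k : ℕ} (hs : s ≤ k) :
    (piK k / piK s) * (2 * lamS c s ^ 2)
      ≤ 18 / (c ^ 2 * ((k : ℝ) + 2)) / ((k : ℝ) + 1) := by
  have hsk : (s : ℝ) ≤ k := by exact_mod_cast hs
  have h : (piK k / piK s) * (2 * lamS c s ^ 2)
      = 18 / (c ^ 2 * ((k : ℝ) + 2)) / ((k : ℝ) + 1)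
        * (((s : ℝ) + 1) / (k + 1) * ((s + 1) / (s + 2))) := by
    unfold piK lamS
    field_simp
    ring
  rw [h]
  refine mul_le_of_le_one_right (by positivity) (mul_le_one₀ ?_ (by positivity) ?_)
  · exact (div_le_one (by positivity)).2 (by linarith)
  · exact (div_le_one (by positivity)).2 (by linarith)

/-- `Σ_{s=0}^{k} (π_k/π_s)(2λ_s²) ≤ 18/(c²(k+2))`. -/
theorem stmt_14 (c : ℝ) (hc : 0 < c) (k : ℕ) :
    ∑ s ∈ Finset.range (k + 1), (piK k / piK s) * (2 * lamS c s ^ 2)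
      ≤ 18 / (c ^ 2 * ((k : ℝ) + 2)) := by
  refine (Finset.sum_le_card_nsmul _ _ _ fun s hs =>
    piK_div_mul_lamS_sq_le hc (Finset.mem_range_succ_iff.1 hs)).trans_eq ?_
  rw [Finset.card_range, nsmul_eq_mul]
  push_cast
  field_simp
end

section
/- Let c > 0, M, G be real numbers, define λ_k = 3/(c(k+2)) and η_k = 1/((k+2)(k+1)), and let (a_k)_{k≥0} be a sequence of nonnegative real numbers satisfying, for every natural number k, a_{k+1} ≤ (1 − cλ_k + η_k) a_k + η_k G² + 2λ_k² M² + 2η_k² G². Then for every natural number k, a_{k+1} ≤ [2/((k+1)(k+2)) + 1/(2(k+2))] G² + 18 M² / (c²(k+2)). -/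
/-- Averaging step size `λ_k = 3/(c(k+2))`. -/
noncomputable def lamK (c : ℝ) (k : ℕ) : ℝ := 3 / (c * ((k : ℝ) + 2))

/-- MA-Echo step size `η_k = 1/((k+2)(k+1))`. -/
noncomputable def etaK (k : ℕ) : ℝ := 1 / (((k : ℝ) + 2) * ((k : ℝ) + 1))

/-- The contraction factor `1 - cλ_k + η_k` equals `k² / ((k+1)(k+2))`. -/
lemma one_sub_mul_lamK_add_etaK {c : ℝ} (hc : c ≠ 0) (k : ℕ) :
    1 - c * lamK c k + etaK k = (k : ℝ) ^ 2 / (((k : ℝ) + 1) * ((k : ℝ) + 2)) := by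
  have h1 : (k : ℝ) + 1 ≠ 0 := by positivity
  have h2 : (k : ℝ) + 2 ≠ 0 := by positivity
  unfold lamK etaK
  field_simp
  ring

/-- One step of the recursion, with the denominators of the previous bound cleared. -/
lemma recursion_step {x a b g m : ℝ} (hx : 0 ≤ x) (hg : 0 ≤ g) (hm : 0 ≤ m)
    (ha : x ^ 2 * (x + 1) * a ≤ (2 * x + x ^ 2 / 2) * g + 18 * x ^ 2 * m)
    (hb : b ≤ x ^ 2 / ((x + 1) * (x + 2)) * a + 1 / ((x + 2) * (x + 1)) * g
      + 18 / (x + 2) ^ 2 * m + 2 / ((x + 2) * (x + 1)) ^ 2 * g) :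
    b ≤ (2 / ((x + 1) * (x + 2)) + 1 / (2 * (x + 2))) * g + 18 * m / (x + 2) := by
  have ha' : x ^ 2 / ((x + 1) * (x + 2)) * a
      ≤ ((2 * x + x ^ 2 / 2) * g + 18 * x ^ 2 * m) / ((x + 1) ^ 2 * (x + 2)) := by
    rw [le_div_iff₀ (by positivity)]
    refine le_of_eq_of_le ?_ ha
    field_simp
  refine hb.trans ((add_le_add_left (add_le_add_left (add_le_add_left ha' _) _) _).trans ?_)
  rw [← sub_nonneg]
  have key : (2 / ((x + 1) * (x + 2)) + 1 / (2 * (x + 2))) * g + 18 * m / (x + 2)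
      - (((2 * x + x ^ 2 / 2) * g + 18 * x ^ 2 * m) / ((x + 1) ^ 2 * (x + 2))
        + 1 / ((x + 2) * (x + 1)) * g + 18 / (x + 2) ^ 2 * m
        + 2 / ((x + 2) * (x + 1)) ^ 2 * g)
      = ((3 / 2 * x + 1) * g + 18 * (x ^ 2 + 3 * x + 1) * m)
        / ((x + 1) ^ 2 * (x + 2) ^ 2) := by
    field_simp
    ring
  rw [key]
  positivity

/-- Proposition 2 (quantitative bound): any nonnegative sequence satisfying the one-step
recursion `a_{k+1} ≤ (1 − cλ_k + η_k) a_k + η_k G² + 2λ_k² M² + 2η_k² G²` satisfies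
`a_{k+1} ≤ [2/((k+1)(k+2)) + 1/(2(k+2))] G² + 18M²/(c²(k+2))`. -/
theorem stmt_15 (c M G : ℝ) (hc : 0 < c) (a : ℕ → ℝ) (ha : ∀ k, 0 ≤ a k)
    (hrec : ∀ k : ℕ, a (k + 1) ≤ (1 - c * lamK c k + etaK k) * a k
      + etaK k * G ^ 2 + 2 * lamK c k ^ 2 * M ^ 2 + 2 * etaK k ^ 2 * G ^ 2) :
    ∀ k : ℕ, a (k + 1)
      ≤ (2 / (((k : ℝ) + 1) * ((k : ℝ) + 2)) + 1 / (2 * ((k : ℝ) + 2))) * G ^ 2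
        + 18 * M ^ 2 / (c ^ 2 * ((k : ℝ) + 2)) := by
  have step (k : ℕ) (h : (k : ℝ) ^ 2 * (k + 1) * a k
      ≤ (2 * k + (k : ℝ) ^ 2 / 2) * G ^ 2 + 18 * (k : ℝ) ^ 2 * (M ^ 2 / c ^ 2)) :
      a (k + 1) ≤ (2 / (((k : ℝ) + 1) * ((k : ℝ) + 2)) + 1 / (2 * ((k : ℝ) + 2))) * G ^ 2
        + 18 * (M ^ 2 / c ^ 2) / ((k : ℝ) + 2) := by
    refine recursion_step k.cast_nonneg (sq_nonneg G) (by positivity) h ((hrec k).trans_eq ?_)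
    rw [one_sub_mul_lamK_add_etaK hc.ne']
    unfold lamK etaK
    field_simp
    ring
  have bound (k : ℕ) : (k : ℝ) ^ 2 * (k + 1) * a k
      ≤ (2 * k + (k : ℝ) ^ 2 / 2) * G ^ 2 + 18 * (k : ℝ) ^ 2 * (M ^ 2 / c ^ 2) := by
    induction k with
    | zero => simp
    | succ k ih =>
      push_cast
      refine (mul_le_mul_of_nonneg_left (step k ih) (by positivity)).trans_eq ?_
      field_simp
      ring
  intro k
  refine (step k (bound k)).trans_eq ?_
  field_simp
end

section
/- Let E be a finite-dimensional real inner product space, S ⊆ E a nonempty closed set, and c > 0, B, G real numbers. Define λ_k = 3/(c(k+2)) and η_k = 1/((k+2)(k+1)). Let (w_k), (g_k), (d_k) be sequences in E with w_{k+1} = w_k − λ_k g_k + η_k d_k, ‖g_k‖ ≤ B and ‖d_k‖ ≤ G for all k, and suppose that for each k there exists p_k ∈ S with ‖w_k − p_k‖ = infDist(w_k, S) and ⟨p_k − w_k, g_k⟩ ≤ −(c/2)‖w_k − p_k‖². Then for every natural number k, (infDist(w_{k+1}, S))² ≤ [2/((k+1)(k+2)) + 1/(2(k+2))] G² + 18 B²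 / (c²(k+2)). -/
open RealInnerProductSpace

/-- One perturbed gradient step `v - s • g + t • d` contracts the squared norm, up to errors
controlled by `‖d‖` and `‖g‖`; `r` is the weight in Young's inequality for `⟪v, d⟫`. -/
theorem norm_sq_sub_smul_add_smul_le {E : Type*} [NormedAddCommGroup E] [InnerProductSpace ℝ E]
    {v g d : E} {c s t r B G : ℝ} (hs : 0 ≤ s) (hr : 0 < r)
    (hg : ‖g‖ ≤ B) (hd : ‖d‖ ≤ G) (hv : c / 2 * ‖v‖ ^ 2 ≤ ⟪v, g⟫) :
    ‖v - s • g + t • d‖ ^ 2 ≤ (1 - s * c + r) * ‖v‖ ^ 2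
      + (t ^ 2 / r + 2 * t ^ 2) * G ^ 2 + 2 * s ^ 2 * B ^ 2 := by
  have expand : ‖v - s • g + t • d‖ ^ 2 = ‖v‖ ^ 2 - 2 * s * ⟪v, g⟫ + 2 * t * ⟪v, d⟫
      + ‖t • d - s • g‖ ^ 2 := by
    rw [show v - s • g + t • d = v + (t • d - s • g) by abel, norm_add_sq_real, inner_sub_right,
      real_inner_smul_right, real_inner_smul_right]
    ring
  have hG : ‖d‖ ^ 2 ≤ G ^ 2 := by gcongr
  have hB : ‖g‖ ^ 2 ≤ B ^ 2 := by gcongr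
  have young : 2 * t * ⟪v, d⟫ ≤ r * ‖v‖ ^ 2 + t ^ 2 / r * ‖d‖ ^ 2 := by
    have h := sq_nonneg ‖r • v - t • d‖
    rw [norm_sub_sq_real, real_inner_smul_left, real_inner_smul_right, norm_smul, norm_smul,
      mul_pow, mul_pow, Real.norm_eq_abs, Real.norm_eq_abs, sq_abs, sq_abs] at h
    have h' := div_nonneg h hr.le
    have e : (r ^ 2 * ‖v‖ ^ 2 - 2 * (r * (t * ⟪v, d⟫)) + t ^ 2 * ‖d‖ ^ 2) / r
        = r * ‖v‖ ^ 2 - 2 * t * ⟪v, d⟫ + t ^ 2 / r * ‖d‖ ^ 2 := by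
      field_simp
    linarith
  have parallelogram : ‖t • d - s • g‖ ^ 2 ≤ 2 * t ^ 2 * ‖d‖ ^ 2 + 2 * s ^ 2 * ‖g‖ ^ 2 := by
    have h := parallelogram_law_with_norm ℝ (t • d) (s • g)
    have ht : ‖t • d‖ * ‖t • d‖ = t ^ 2 * ‖d‖ ^ 2 := by
      rw [← sq, norm_smul, mul_pow, Real.norm_eq_abs, sq_abs]
    have hs : ‖s • g‖ * ‖s • g‖ = s ^ 2 * ‖g‖ ^ 2 := by
      rw [← sq, norm_smul, mul_pow, Real.norm_eq_abs, sq_abs]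
    nlinarith [mul_self_nonneg ‖t • d + s • g‖]
  have hsv := mul_le_mul_of_nonneg_left hv hs
  have hdG : (t ^ 2 / r + 2 * t ^ 2) * ‖d‖ ^ 2 ≤ (t ^ 2 / r + 2 * t ^ 2) * G ^ 2 := by gcongr
  have hgB : 2 * s ^ 2 * ‖g‖ ^ 2 ≤ 2 * s ^ 2 * B ^ 2 := by gcongr
  linarith

/-- A sequence with the one-step recursion of the scheme, `X` and `Y` bounding the squared sizes
of the perturbations, decays at the stated rate. -/
theorem le_of_contraction_recursion {a : ℕ → ℝ} {X Y : ℝ} (hX : 0 ≤ X) (hY : 0 ≤ Y)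
    (h : ∀ k : ℕ, a (k + 1) ≤ k / (k + 2) * a k
      + (k + 4) / ((k + 2) ^ 2 * (k + 1) ^ 2) * X + Y / (k + 2) ^ 2) (k : ℕ) :
    a (k + 1) ≤ (2 / ((k + 1) * (k + 2)) + 1 / (2 * (k + 2))) * X + Y / (k + 2) := by
  have h0 := h 0
  have h1 := h 1
  norm_num at h0 h1
  induction k with
  | zero => norm_num; linarith
  | succ k ih =>
    rcases k with _ | k
    · norm_num; linarith
    · have hk := h (k + 2)
      push_cast at ih hk ⊢
      have hm := mul_le_mul_of_nonneg_left ih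
        (show (0 : ℝ) ≤ ((k : ℝ) + 2) / (k + 2 + 2) by positivity)
      have gapX : 0 ≤ ((k : ℝ) * (k + 5) / (2 * (k + 3) ^ 2 * (k + 4) ^ 2)) * X := by positivity
      have gapY : 0 ≤ Y / (((k : ℝ) + 3) * (k + 4) ^ 2) := by positivity
      have key : (2 / (((k : ℝ) + 1 + 1 + 1) * (k + 1 + 1 + 2)) + 1 / (2 * (k + 1 + 1 + 2))) * X
          + Y / (k + 1 + 1 + 2)
          = ((k : ℝ) + 2) / (k + 2 + 2) * ((2 / ((k + 1 + 1) * (k + 1 + 2))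
              + 1 / (2 * (k + 1 + 2))) * X + Y / (k + 1 + 2))
            + (k + 2 + 4) / ((k + 2 + 2) ^ 2 * (k + 2 + 1) ^ 2) * X + Y / (k + 2 + 2) ^ 2
            + ((k : ℝ) * (k + 5) / (2 * (k + 3) ^ 2 * (k + 4) ^ 2)) * X
            + Y / (((k : ℝ) + 3) * (k + 4) ^ 2) := by
        ring_nf
        field_simp
        ring
      rw [key]
      exact hk.trans (by linarith)

/-- Proposition 2 in sequence form: with step sizes `λ_k = 3/(c(k+2))`,
`η_k = 1/((k+2)(k+1))`, updates `w_{k+1} = w_k − λ_k g_k + η_k d_k`, bounded updates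
`‖g_k‖ ≤ B`, `‖d_k‖ ≤ G`, and a nearest point `p_k ∈ S` satisfying the strong-convexity
descent property, the squared distance to `S` satisfies the quantitative bound. -/
theorem stmt_16 {E : Type*} [NormedAddCommGroup E] [InnerProductSpace ℝ E]
    [FiniteDimensional ℝ E]
    (S : Set E) (hS : S.Nonempty) (hSclosed : IsClosed S)
    (c B G : ℝ) (hc : 0 < c)
    (w g d : ℕ → E)
    (hupd : ∀ k : ℕ, w (k + 1)
      = w k - (3 / (c * ((k : ℝ) + 2))) • g k
          + (1 / (((k : ℝ) + 2) * ((k : ℝ) + 1))) • d k)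
    (hg : ∀ k, ‖g k‖ ≤ B) (hd : ∀ k, ‖d k‖ ≤ G)
    (hproj : ∀ k : ℕ, ∃ p ∈ S, ‖w k - p‖ = Metric.infDist (w k) S ∧
      ⟪p - w k, g k⟫ ≤ -(c / 2) * ‖w k - p‖ ^ 2) :
    ∀ k : ℕ, (Metric.infDist (w (k + 1)) S) ^ 2
      ≤ (2 / (((k : ℝ) + 1) * ((k : ℝ) + 2)) + 1 / (2 * ((k : ℝ) + 2))) * G ^ 2
        + 18 * B ^ 2 / (c ^ 2 * ((k : ℝ) + 2)) := by
  have step (k : ℕ) : Metric.infDist (w (k + 1)) S ^ 2 ≤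
      k / (k + 2) * Metric.infDist (w k) S ^ 2
      + (k + 4) / ((k + 2) ^ 2 * (k + 1) ^ 2) * G ^ 2
      + (18 * B ^ 2 / c ^ 2) / (k + 2) ^ 2 := by
    obtain ⟨p, hpS, hp, hin⟩ := hproj k
    have hv : c / 2 * ‖w k - p‖ ^ 2 ≤ ⟪w k - p, g k⟫ := by
      rw [← neg_sub, inner_neg_left] at hin
      linarith
    have hle : Metric.infDist (w (k + 1)) S ≤ ‖w (k + 1) - p‖ := by
      rw [← dist_eq_norm]
      exact Metric.infDist_le_dist_of_mem hpS
    have hw : w (k + 1) - p = (w k - p) - (3 / (c * ((k : ℝ) + 2))) • g k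
        + (1 / (((k : ℝ) + 2) * ((k : ℝ) + 1))) • d k := by
      rw [hupd]
      abel
    have hstep := norm_sq_sub_smul_add_smul_le (s := 3 / (c * ((k : ℝ) + 2)))
      (t := 1 / (((k : ℝ) + 2) * ((k : ℝ) + 1))) (r := 1 / ((k : ℝ) + 2))
      (by positivity) (by positivity) (hg k) (hd k) hv
    rw [← hw, hp] at hstep
    calc Metric.infDist (w (k + 1)) S ^ 2 ≤ ‖w (k + 1) - p‖ ^ 2 :=
          pow_le_pow_left₀ Metric.infDist_nonneg hle 2
      _ ≤ _ := hstep
      _ = _ := by field_simp; ring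
  intro k
  have h := le_of_contraction_recursion (a := fun k => Metric.infDist (w k) S ^ 2)
    (sq_nonneg G) (by positivity : 0 ≤ 18 * B ^ 2 / c ^ 2) step k
  rwa [div_div] at h
end
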